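/- Let (Δ,Θ) be a directive bi-sequence with associated prefixes (w_n), let n ≥ 2, and suppose the prefix of length n of (Δ,Θ) is normalized. Suppose the triple ((δ_{n−1}, δ_n, δ_{n+1}), (ϑ_{n−1}, ϑ_n, ϑ_{n+1})) has one of the following forms, where i, j ∈ {0,1,2} are distinct letters and a, b₁, b₂ are letters: (1) ((a, b₁, b₂), (R, E_i, E_i)) with b₁ = E_i(b₂), excluding the case where (δ_{n−1}, δ_n, δ_{n+1}) = (i, i, i) and w_{n−1} = i^{n−1}; (2) ((a, b₁, b₂), (E_i, R, R)) with b₁ = E_i(b₂), excluding the case where (δ_{n−1}, δ_n, δ_{n+1}) = (i, i, i) and w_{n−1} = i^{n−1}; (3) ((a, b₁, b₂), (E_i, E_j, E_i)) with E_i(b₁) = E_j(b₂). Then exactly one pseudopalindromic prefix is missed between w_n and w_{n+1}. -/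

import Mathlib

/-- The ternary alphabet. -/
abbrev Letter := Fin 3

/-- Finite words over the ternary alphabet. -/
abbrev Word := List Letter

/-- The four involutory antimorphisms of ternary words: the reversal `R`
and, for each letter `i`, the antimorphism `E i`. -/
inductive AM where
  | R : AM
  | E : Letter → AM
deriving DecidableEq

/-- The action of an antimorphism on a single letter: `R` fixes every letter,
and `E i` fixes `i` and exchanges the other two letters (in `Fin 3`,
this involution is `a ↦ -(i + a)`). -/
def AM.letter : AM → Letter → Letter
  | .R, _a => _a
  | .E i, a => -(i + a)

/-- The action of an antimorphism on a word: letterwise image followed by reversal. -/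
def AM.apply (t : AM) (w : Word) : Word := (w.map t.letter).reverse

/-- A word is a pseudopalindrome if it is a `ϑ`-palindrome for some
`ϑ ∈ {R, E_0, E_1, E_2}`. -/
def IsPseudopal (w : Word) : Prop := ∃ t : AM, t.apply w = w

/-- `v` is an image of `w` if `v = ϑ(w)` for some `ϑ ∈ {R, E_0, E_1, E_2}`. -/
def IsImage (w v : Word) : Prop := ∃ t : AM, v = t.apply w

/-- `v` is the `ϑ`-palindromic closure of `u`: the shortest `ϑ`-palindrome
having `u` as a prefix. -/
def IsPalClosure (t : AM) (u v : Word) : Prop :=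
  u <+: v ∧ t.apply v = v ∧
    ∀ v' : Word, u <+: v' → t.apply v' = v' → v.length ≤ v'.length

/-- `w` is the sequence of prefixes associated with the directive bi-sequence
`(Δ, Θ)`: `w 0 = ε` and `w (n+1) = (w n · δ_{n+1})^{ϑ_{n+1}}`. -/
def DirectivePrefixes (Δ : ℕ → Letter) (Θ : ℕ → AM) (w : ℕ → Word) : Prop :=
  w 0 = [] ∧ ∀ n : ℕ, IsPalClosure (Θ (n + 1)) (w n ++ [Δ (n + 1)]) (w (n + 1))

/-- A pseudopalindromic prefix `v` of `w_{n+1}` is missed between `w_n` and `w_{n+1}`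
if `|w_n| < |v| < |w_{n+1}|`. -/
def MissedBetween (wn wn1 v : Word) : Prop :=
  v <+: wn1 ∧ IsPseudopal v ∧ wn.length < v.length ∧ v.length < wn1.length

/-- An image of `u` occurs in `v` at (0-indexed) position `p`. -/
def OccursImageAt (u v : Word) (p : ℕ) : Prop :=
  p + u.length ≤ v.length ∧ IsImage u ((v.drop p).take u.length)

/-- Assumption A for the pair `(wn, wn1)`: some image of `wn` occurs in `wn1`
at a position `p` with `0 < p < |wn1| - |wn|`, overlapping both the prefix
occurrence of `wn` and the suffix occurrence of an image of `wn`. -/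
def AssumptionA (wn wn1 : Word) : Prop :=
  ∃ p : ℕ, 0 < p ∧ p < wn1.length - wn.length ∧ p < wn.length ∧
    wn1.length - wn.length < p + wn.length ∧ OccursImageAt wn wn1 p

/-- The prefix of length `n` of the directive bi-sequence is normalized:
every pseudopalindromic prefix of `w n` equals `w k` for some `k ≤ n`. -/
def NormalizedUpTo (w : ℕ → Word) (n : ℕ) : Prop :=
  ∀ v : Word, v <+: w n → IsPseudopal v → ∃ k : ℕ, k ≤ n ∧ v = w k

/-- `rep u l` is the `l`-fold concatenation `u^l`. -/
def rep (u : Word) (l : ℕ) : Word := (List.replicate l u).flatten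

/-- `rmSuf x y` is `x · y⁻¹`: the word `x` with its suffix of length `|y|` removed. -/
def rmSuf (x y : Word) : Word := x.take (x.length - y.length)

/-- `v` is a prefix of the infinite periodic word `pat^ω`. -/
def IsPrefixOfPow (pat v : Word) : Prop :=
  ∀ q : ℕ, ∀ hq : q < v.length, ∃ hp : q % pat.length < pat.length,
    v.get ⟨q, hq⟩ = pat.get ⟨q % pat.length, hp⟩

/-- Reversing the first `m` values of `x` and applying the letter map `g` gives them back. -/
def PrefixSym (x : ℕ → Letter) (g : Letter → Letter) (m : ℕ) : Prop :=
  ∀ i j, i + j + 1 = m → x i = g (x j)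

/-- The letters of a word as a total function, extended by `0`. -/
def letters (v : Word) (k : ℕ) : Letter := v.getD k 0

theorem letters_eq_of_prefixed {u v : Word} (h : u <+: v) {k : ℕ} (hk : k < u.length) :
    letters u k = letters v k := by
  obtain ⟨s, rfl⟩ := h
  simp [letters, List.getD_eq_getElem?_getD, List.getElem?_append_left hk]

theorem letters_concat (u : Word) (b : Letter) : letters (u ++ [b]) u.length = b := by
  simp [letters]

theorem word_ext {u v : Word} (hl : u.length = v.length)
    (h : ∀ k < u.length, letters u k = letters v k) : u = v := by
  refine List.ext_getElem hl fun k h1 h2 => ?_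
  simpa [letters, List.getD_eq_getElem, h1, h2] using h k h1

theorem letters_ofFn (x : ℕ → Letter) (m : ℕ) {k : ℕ} (hk : k < m) :
    letters (List.ofFn fun i : Fin m => x i) k = x k := by
  simp [letters, hk]

theorem AM.letter_letter (t : AM) (a : Letter) : t.letter (t.letter a) = a := by
  cases t with
  | R => rfl
  | E i => simp [AM.letter]

theorem AM.length_apply (t : AM) (v : Word) : (t.apply v).length = v.length := by
  simp [AM.apply]

theorem AM.letters_apply (t : AM) (v : Word) {i j : ℕ} (h : i + j + 1 = v.length) :
    letters (t.apply v) i = t.letter (letters v j) := by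
  have hi : i < (t.apply v).length := by rw [t.length_apply]; omega
  have hj : j < v.length := by omega
  have hij : v.length - 1 - i = j := by omega
  rw [letters, letters, List.getD_eq_getElem _ _ hi, List.getD_eq_getElem _ _ hj]
  simp [AM.apply, hij]

theorem AM.apply_eq_self_iff (t : AM) (v : Word) :
    t.apply v = v ↔ PrefixSym (letters v) t.letter v.length := by
  constructor
  · intro h i j hij
    rw [← t.letters_apply v hij, h]
  · intro h
    refine word_ext (t.length_apply v) fun k hk => ?_
    rw [t.length_apply] at hk
    have hij : k + (v.length - 1 - k) + 1 = v.length := by omega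
    rw [t.letters_apply v hij, ← h _ _ hij]

theorem PrefixSym.congr {x y : ℕ → Letter} {f g : Letter → Letter} {m : ℕ} (h : PrefixSym x f m)
    (hxy : ∀ k < m, x k = y k) (hfg : ∀ a, f a = g a) : PrefixSym y g m := by
  intro i j hij
  rw [← hxy i (by omega), ← hxy j (by omega), h i j hij, hfg]

theorem AM.exists_conj (s t : AM) :
    ∃ r : AM, ∀ a, r.letter a = s.letter (t.letter (s.letter a)) := by
  cases s with
  | R => exact ⟨t, fun a => rfl⟩
  | E i =>
    cases t with
    | R => exact ⟨.R, fun a => by simp [AM.letter]⟩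
    | E j =>
      have h : ∃ k, ∀ a, (AM.E k).letter a
          = (AM.E i).letter ((AM.E j).letter ((AM.E i).letter a)) := by
        revert i j; decide
      obtain ⟨k, hk⟩ := h
      exact ⟨_, hk⟩

/-- A product of three letter involutions is again a letter involution, or a 3-cycle. -/
theorem AM.exists_comp_or_cycle (s t u : AM) :
    (∃ r : AM, ∀ a, r.letter a = s.letter (t.letter (u.letter a))) ∨
      ∀ a, s.letter (t.letter (u.letter (s.letter (t.letter (u.letter a))))) ≠ a := by
  have h : (∀ a, AM.R.letter a = s.letter (t.letter (u.letter a))) ∨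
      (∃ k, ∀ a, (AM.E k).letter a = s.letter (t.letter (u.letter a))) ∨
      ∀ a, s.letter (t.letter (u.letter (s.letter (t.letter (u.letter a))))) ≠ a := by
    cases s with
    | R =>
      cases t with
      | R => cases u with
        | R => decide
        | E k => revert k; decide
      | E j => cases u with
        | R => revert j; decide
        | E k => revert j k; decide
    | E i =>
      cases t with
      | R => cases u with
        | R => revert i; decide
        | E k => revert i k; decide
      | E j => cases u with
        | R => revert i j; decide
        | E k => revert i j k; decide
  rcases h with h | ⟨k, h⟩ | h
  · exact .inl ⟨_, h⟩
  · exact .inl ⟨_, h⟩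
  · exact .inr h

/-- A symmetric suffix of `u` bounds the length of its palindromic closure. -/
theorem IsPalClosure.length_le {t : AM} {u v : Word} (h : IsPalClosure t u v) {m : ℕ}
    (h1 : u.length ≤ m) (h2 : m ≤ 2 * u.length)
    (hs : ∀ i j, i + j + 1 = m → i < u.length → j < u.length →
      letters u i = t.letter (letters u j)) : v.length ≤ m := by
  set y : ℕ → Letter := fun k =>
    if k < u.length then letters u k else t.letter (letters u (m - 1 - k)) with hy
  have hlen : (List.ofFn fun i : Fin m => y i).length = m := by simp
  have hpre : u <+: List.ofFn fun i : Fin m => y i := by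
    rw [List.prefix_iff_eq_take]
    refine word_ext (by simp [h1]) fun k hk => ?_
    rw [letters_eq_of_prefixed (List.take_prefix u.length (List.ofFn fun i : Fin m => y i))
      (by simp; omega), letters_ofFn y m (by omega)]
    simp [hy, hk]
  have hpal : t.apply (List.ofFn fun i : Fin m => y i) = List.ofFn fun i : Fin m => y i := by
    rw [AM.apply_eq_self_iff, hlen]
    refine PrefixSym.congr (x := y) (f := t.letter) ?_ (fun k hk => (letters_ofFn y m hk).symm)
      fun _ => rfl
    intro i j hij
    have e1 : m - 1 - i = j := by omega
    have e2 : m - 1 - j = i := by omega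
    by_cases hi : i < u.length <;> by_cases hj : j < u.length
    · simp [hy, hi, hj, hs i j hij hi hj]
    · simp [hy, hi, hj, e2, t.letter_letter]
    · simp [hy, hi, hj, e1]
    · omega
  simpa [hlen] using h.2.2 _ hpre hpal

/-- Symmetry of a prefix extends over one period of a word with `x (k + d) = β (α (x k))`. -/
theorem PrefixSym.add_period {x : ℕ → Letter} {α β : AM} {d m : ℕ} {g : Letter → Letter}
    (hx : ∀ k, x (k + d) = β.letter (α.letter (x k))) (hm : d ≤ m) (h : PrefixSym x g m)
    (hg : ∀ a, β.letter (α.letter (g (β.letter (α.letter a)))) = g a) :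
    PrefixSym x (fun a => β.letter (α.letter (g a))) (m + d) := by
  intro i j hij
  by_cases hi : d ≤ i
  · obtain ⟨i, rfl⟩ := Nat.exists_eq_add_of_le' hi
    rw [hx, h i j (by omega)]
  · obtain ⟨j, rfl⟩ := Nat.exists_eq_add_of_le' (show d ≤ j by omega)
    simp only [hx, hg]
    exact h i j (by omega)

theorem PrefixSym.sub_period {x : ℕ → Letter} {α β : AM} {d m : ℕ} {g : Letter → Letter}
    (hx : ∀ k, x (k + d) = β.letter (α.letter (x k))) (h : PrefixSym x g (m + d)) :
    PrefixSym x (fun a => α.letter (β.letter (g a))) m := by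
  intro i j hij
  have := h (i + d) j (by omega)
  rw [hx] at this
  simp [← this, AM.letter_letter]

/-- Let `w` be the `β`-closure of `p b₁` with `p` an `α`-palindrome, and `z` the `γ`-closure of
`w b₂`. If `γ` and `b₂` are such that the relation `x (k + d) = β (α (x k))`, which `w` satisfies
for `d = |w| - |p|`, is continued by `w b₂`, then exactly one pseudopalindromic prefix is missed
between `w` and `z`. -/
theorem existsUnique_missed_of_period {α β γ : AM} {p w z : Word} {b₁ b₂ : Letter}
    (hγ : ∀ a, γ.letter a =
      β.letter (α.letter (β.letter (α.letter (β.letter a)))))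
    (hb : b₂ = β.letter (α.letter b₁))
    (hp : α.apply p = p) (hw : IsPalClosure β (p ++ [b₁]) w)
    (hz : IsPalClosure γ (w ++ [b₂]) z)
    (hnorm : ∀ v, v <+: w → IsPseudopal v → v.length ≤ p.length ∨ v.length = w.length)
    (hexcl : α.letter (β.letter b₁) = b₁ →
      ¬ PrefixSym (letters p) (fun a => α.letter (β.letter (α.letter a))) p.length) :
    ∃! v : Word, MissedBetween w z v := by
  have hp' := (α.apply_eq_self_iff p).1 hp
  have hw' := (β.apply_eq_self_iff w).1 hw.2.1
  have hz' := (γ.apply_eq_self_iff z).1 hz.2.1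
  have hpw : p.length + 1 ≤ w.length := by simpa using hw.1.length_le
  have hwz : w.length + 1 ≤ z.length := by simpa using hz.1.length_le
  have hw2 : w.length ≤ 2 * p.length + 2 :=
    hw.length_le (m := 2 * p.length + 2) (by simp; omega) (by simp; omega)
      fun i j hij hi hj => by simp at hi hj; omega
  obtain ⟨d, hd⟩ := Nat.exists_eq_add_of_le (show p.length ≤ w.length by omega)
  have hwp : ∀ k < p.length, letters w k = letters p k := fun k hk =>
    (letters_eq_of_prefixed ((List.prefix_append p [b₁]).trans hw.1) hk).symm
  have hwb : letters w p.length = b₁ := by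
    rw [← letters_eq_of_prefixed hw.1 (by simp), letters_concat]
  have hzw : ∀ k < w.length, letters z k = letters w k := fun k hk =>
    (letters_eq_of_prefixed ((List.prefix_append w [b₂]).trans hz.1) hk).symm
  have hzb : letters z w.length = b₂ := by
    rw [← letters_eq_of_prefixed hz.1 (by simp), letters_concat]
  have hwper : ∀ k, k + d < w.length → letters w (k + d) = β.letter (α.letter (letters w k)) := by
    intro k hk
    have h1 := hw' (k + d) (p.length - 1 - k) (by omega)
    have h2 := hp' (p.length - 1 - k) k (by omega)
    rw [h1, hwp _ (by omega), h2, hwp _ (by omega)]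
  set X : ℕ → Letter := fun k =>
    (fun a => β.letter (α.letter a))^[k / d] (letters w (k % d)) with hX
  have hXper : ∀ k, X (k + d) = β.letter (α.letter (X k)) := by
    intro k
    simp only [hX]
    rw [Nat.add_div_right k (by omega), Nat.add_mod_right, Function.iterate_succ_apply']
  have hXw : ∀ k < w.length, X k = letters w k := by
    intro k
    induction k using Nat.strong_induction_on with
    | _ k ih =>
      intro hk
      by_cases hkd : d ≤ k
      · obtain ⟨k, rfl⟩ := Nat.exists_eq_add_of_le' hkd
        rw [hXper, hwper k hk, ih k (by omega) (by omega)]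
      · simp [hX, Nat.div_eq_of_lt (not_le.1 hkd), Nat.mod_eq_of_lt (not_le.1 hkd)]
  have hXb : X w.length = b₂ := by rw [hd, hXper, hXw _ (by omega), hwb, hb]
  have hS1 : PrefixSym X β.letter w.length := hw'.congr (fun k hk => (hXw k hk).symm) fun _ => rfl
  have hS2 := hS1.add_period hXper (by omega) (by simp [AM.letter_letter])
  have hS3 := hS2.add_period hXper (by omega) (by simp [AM.letter_letter])
  have hS3' : PrefixSym X γ.letter (w.length + d + d) :=
    hS3.congr (fun _ _ => rfl) fun a => (hγ a).symm
  have hXu : ∀ k < (w ++ [b₂]).length, letters (w ++ [b₂]) k = X k := by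
    intro k hk
    rw [letters_eq_of_prefixed hz.1 hk]
    rcases Nat.lt_or_ge k w.length with h | h
    · rw [hzw k h, hXw k h]
    · obtain rfl : k = w.length := by simp at hk; omega
      rw [hzb, hXb]
  have hzle : z.length ≤ w.length + d + d :=
    hz.length_le (by simp; omega) (by simp; omega) fun i j hij hi hj => by
      rw [hXu i hi, hXu j hj]; exact hS3' i j hij
  have hzlen : z.length = w.length + d + d := by
    by_contra hne
    by_cases h2 : z.length ≤ 2 * w.length
    · obtain ⟨m, hm⟩ := Nat.exists_eq_add_of_le' h2
      have hsym : PrefixSym (letters w) (fun a => α.letter (β.letter (α.letter a))) m := by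
        intro i j hij
        have e1 := hw' i (w.length - 1 - i) (by omega)
        have e2 := hz' (w.length - 1 - i) (w.length - 1 - j) (by omega)
        have e3 := hw' (w.length - 1 - j) j (by omega)
        rw [hzw _ (by omega), hzw _ (by omega)] at e2
        rw [e1, e2, e3, hγ]
        simp [AM.letter_letter]
      have hlet : letters w m = α.letter (β.letter b₁) := by
        have e1 := hw' m (w.length - 1 - m) (by omega)
        have e2 := hz' (w.length - 1 - m) w.length (by omega)
        rw [hzw _ (by omega), hzb] at e2
        rw [e1, e2, hγ, hb]
        simp [AM.letter_letter]
      have hmp : m ≤ p.length := by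
        have hlen : (w.take m).length = m := by simp; omega
        obtain ⟨r, hr⟩ := α.exists_conj β
        rcases hnorm (w.take m) (List.take_prefix _ _) ⟨r, (r.apply_eq_self_iff _).2 <| by
          rw [hlen]
          exact hsym.congr (fun k hk => (letters_eq_of_prefixed (List.take_prefix m w)
            (by omega)).symm) fun a => (hr a).symm⟩ with h | h <;> omega
      rcases hmp.eq_or_lt with rfl | hmp
      · exact hexcl (by rw [← hlet, hwb])
          (hsym.congr hwp fun _ => rfl)
      · have : w.length ≤ 2 * p.length - m := by
          refine hw.length_le (by simp; omega) (by simp; omega) fun i j hij hi hj => ?_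
          simp only [List.length_append, List.length_singleton] at hi hj
          have key : ∀ k ≤ p.length, letters (p ++ [b₁]) k = letters w k := fun k hk =>
            letters_eq_of_prefixed hw.1 (by simp; omega)
          rw [key i (by omega), key j (by omega)]
          have hend : letters w (p.length - 1 - m) = β.letter b₁ := by
            rw [hwp _ (by omega), hp' (p.length - 1 - m) m (by omega), ← hwp _ hmp, hlet]
            simp [AM.letter_letter]
          rcases Nat.lt_or_ge i p.length with hi' | hi'
          · rcases Nat.lt_or_ge j p.length with hj' | hj'
            · have e1 := hp' i (p.length - 1 - i) (by omega)
              have e2 := hsym (p.length - 1 - i) (p.length - 1 - j) (by omega)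
              have e3 := hp' (p.length - 1 - j) j (by omega)
              rw [hwp _ (by omega), hwp _ (by omega)] at e2
              rw [hwp _ hi', hwp _ hj', e1, e2, e3]
              simp [AM.letter_letter]
            · obtain rfl : j = p.length := by omega
              obtain rfl : i = p.length - 1 - m := by omega
              rw [hend, hwb]
          · obtain rfl : i = p.length := by omega
            obtain rfl : j = p.length - 1 - m := by omega
            rw [hend, hwb, AM.letter_letter]
        omega
    · have hfix : β.letter b₁ = b₁ := by
        have e := hz' w.length w.length (by omega)
        rw [hzb, hγ, hb] at e
        simp only [AM.letter_letter] at e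
        simpa [AM.letter_letter] using (congrArg (fun a => α.letter (β.letter a)) e).symm
      have : w.length ≤ 2 * p.length + 1 := by
        refine hw.length_le (by simp; omega) (by simp) fun i j hij hi hj => ?_
        simp only [List.length_append, List.length_singleton] at hi hj
        obtain rfl : i = p.length := by omega
        obtain rfl : j = p.length := by omega
        rw [letters_concat, hfix]
      omega
  have hzX : ∀ k < z.length, letters z k = X k := by
    intro k hk
    by_cases hkw : k < (w ++ [b₂]).length
    · rw [← hXu k hkw, letters_eq_of_prefixed hz.1 hkw]
    · simp only [List.length_append, List.length_singleton] at hkw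
      have hj : z.length - 1 - k < (w ++ [b₂]).length := by simp; omega
      rw [hz' k (z.length - 1 - k) (by omega), hS3' k (z.length - 1 - k) (by omega),
        ← hXu _ hj, letters_eq_of_prefixed hz.1 hj]
  have hshort : ∀ (r : AM) (m : ℕ), m ≤ w.length → PrefixSym X r.letter m →
      m ≤ p.length ∨ m = w.length := by
    intro r m hm hs
    have hlen : (w.take m).length = m := by simp; omega
    have := hnorm (w.take m) (List.take_prefix _ _) ⟨r, (r.apply_eq_self_iff _).2 <| by
      rw [hlen]
      exact hs.congr (fun k hk => by
        rw [hXw k (by omega), letters_eq_of_prefixed (List.take_prefix m w) (by omega)]) fun _ => rfl⟩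
    rwa [hlen] at this
  have hlen : (z.take (w.length + d)).length = w.length + d := by simp; omega
  refine ⟨z.take (w.length + d), ⟨List.take_prefix _ _, ?_, by omega, by omega⟩, ?_⟩
  · obtain ⟨r, hr⟩ := β.exists_conj α
    refine ⟨r, (r.apply_eq_self_iff _).2 ?_⟩
    rw [hlen]
    exact hS2.congr (fun k hk => by
      rw [← hzX k (by omega), letters_eq_of_prefixed (List.take_prefix _ z) (by omega)])
      fun a => (hr a).symm
  · rintro v ⟨hvz, ⟨θ, hθ⟩, h1, h2⟩
    have hs : PrefixSym X θ.letter v.length := ((θ.apply_eq_self_iff v).1 hθ).congr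
      (fun k hk => by rw [letters_eq_of_prefixed hvz hk, hzX k (by omega)]) fun _ => rfl
    suffices hv : v.length = w.length + d by
      rw [List.prefix_iff_eq_take.1 hvz, hv]
    by_contra hne
    rcases Nat.lt_or_ge v.length (w.length + d) with hlt | hge
    · obtain ⟨m, hm⟩ := Nat.exists_eq_add_of_le' (show d ≤ v.length by omega)
      rw [hm] at hs
      have hs' := hs.sub_period hXper
      rcases α.exists_comp_or_cycle β θ with ⟨r, hr⟩ | hcyc
      · rcases hshort r m (by omega) (hs'.congr (fun _ _ => rfl) fun a => (hr a).symm) with h | h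
          <;> omega
      · refine hcyc (X 0) ?_
        have e1 := hs' 0 (m - 1) (by omega)
        have e2 := hs' (m - 1) 0 (by omega)
        simp only at e1 e2
        rw [← e2, ← e1]
    · obtain ⟨m, hm⟩ := Nat.exists_eq_add_of_le' (show d + d ≤ v.length by omega)
      have hs' : PrefixSym X (fun a => α.letter (β.letter (θ.letter (β.letter (α.letter a))))) m := by
        intro i j hij
        have e := hs (i + d) (j + d) (by omega)
        rw [hXper, hXper] at e
        simp [← e, AM.letter_letter]
      obtain ⟨r, hr⟩ := β.exists_conj θ
      obtain ⟨q, hq⟩ := α.exists_conj r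
      rcases hshort q m (by omega) (hs'.congr (fun _ _ => rfl) fun a => by rw [hq, hr]) with h | h
        <;> omega

theorem letters_replicate (i : Letter) {m k : ℕ} (hk : k < m) :
    letters (List.replicate m i) k = i := by
  simp [letters, hk]

theorem rep_singleton (i : Letter) (m : ℕ) : rep [i] m = List.replicate m i := by
  simp [rep, List.flatten_replicate_singleton]

section Directive

variable {Δ : ℕ → Letter} {Θ : ℕ → AM} {w : ℕ → Word}

theorem DirectivePrefixes.strictMono_length (hw : DirectivePrefixes Δ Θ w) :
    StrictMono fun k => (w k).length :=
  strictMono_nat_of_lt_succ fun k => by simpa using (hw.2 k).1.length_le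

/-- If `w m` is unary, normalization forces `w m` to have length `m`. -/
theorem DirectivePrefixes.length_eq_of_replicate (hw : DirectivePrefixes Δ Θ w) {m n : ℕ}
    (hnorm : NormalizedUpTo w n) (hmn : w m <+: w n) {i : Letter}
    (hi : ∀ k < (w m).length, letters (w m) k = i) : (w m).length = m := by
  have key : ∀ k ≤ m, (w k).length = k := by
    intro k
    induction k with
    | zero => simp [hw.1]
    | succ k ih =>
      intro hk
      have h1 : (w k).length < (w (k + 1)).length := hw.strictMono_length (Nat.lt_succ_self k)
      have h2 : (w (k + 1)).length ≤ (w m).length := hw.strictMono_length.monotone hk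
      have h3 := ih (by omega)
      have hlen : ((w m).take (k + 1)).length = k + 1 := by simp; omega
      have hlet : ∀ j < k + 1, letters ((w m).take (k + 1)) j = i := fun j hj => by
        rw [letters_eq_of_prefixed (List.take_prefix _ _) (by omega), hi j (by omega)]
      obtain ⟨j, -, hj⟩ := hnorm ((w m).take (k + 1)) ((List.take_prefix _ _).trans hmn)
        ⟨.R, (AM.R.apply_eq_self_iff _).2 fun a b hab => by
          rw [hlet a (by omega), hlet b (by omega)]; rfl⟩
      have hjlen : (w j).length = k + 1 := by rw [← hj, hlen]
      have hkj : k + 1 ≤ j := by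
        by_contra hlt
        have : (w j).length ≤ (w k).length := hw.strictMono_length.monotone (by omega)
        omega
      have : (w (k + 1)).length ≤ (w j).length := hw.strictMono_length.monotone hkj
      omega
  exact key m le_rfl

/-- A prefix `w (m + 1)` invariant under both `R` and `E i` is a power of `i`. -/
theorem DirectivePrefixes.eq_rep (hw : DirectivePrefixes Δ Θ w) {m n : ℕ}
    (hnorm : NormalizedUpTo w n) (hmn : w (m + 1) <+: w n) {i : Letter}
    (hR : PrefixSym (letters (w (m + 1))) AM.R.letter (w (m + 1)).length)
    (hE : PrefixSym (letters (w (m + 1))) (AM.E i).letter (w (m + 1)).length) :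
    Δ (m + 1) = i ∧ w (m + 1) = rep [i] (m + 1) := by
  have hi : ∀ k < (w (m + 1)).length, letters (w (m + 1)) k = i := by
    intro k hk
    have e1 := hR k ((w (m + 1)).length - 1 - k) (by omega)
    have e2 := hE k ((w (m + 1)).length - 1 - k) (by omega)
    have key : ∀ i a : Letter, a = (AM.E i).letter a → a = i := by decide
    refine key i _ ?_
    rw [e1] at e2 ⊢
    exact e2
  have hlen := hw.length_eq_of_replicate hnorm hmn hi
  constructor
  · have h := (hw.2 m).1
    rw [← letters_concat (w m) (Δ (m + 1)), letters_eq_of_prefixed h (by simp)]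
    exact hi _ (hw.strictMono_length (Nat.lt_succ_self m))
  · rw [rep_singleton]
    refine word_ext (by simp [hlen]) fun k hk => ?_
    rw [hi k hk, letters_replicate i (by omega)]

end Directive

/-- Theorem (factor rules, converse direction): if the prefix of length `n` of the
directive bi-sequence is normalized and `(δ_{n-1}δ_nδ_{n+1}, ϑ_{n-1}ϑ_nϑ_{n+1})`
has one of the three listed forms, then exactly one pseudopalindromic prefix is
missed between `w n` and `w (n+1)`. -/
theorem factor_forms_imply_one_missed
    (Δ : ℕ → Letter) (Θ : ℕ → AM) (w : ℕ → Word)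
    (hw : DirectivePrefixes Δ Θ w) (n : ℕ) (hn : 2 ≤ n)
    (hnorm : NormalizedUpTo w n)
    (hform :
      (∃ i : Letter, Θ (n - 1) = AM.R ∧ Θ n = AM.E i ∧ Θ (n + 1) = AM.E i ∧
        Δ n = (AM.E i).letter (Δ (n + 1)) ∧
        ¬(Δ (n - 1) = i ∧ Δ n = i ∧ Δ (n + 1) = i ∧ w (n - 1) = rep [i] (n - 1))) ∨
      (∃ i : Letter, Θ (n - 1) = AM.E i ∧ Θ n = AM.R ∧ Θ (n + 1) = AM.R ∧
        Δ n = (AM.E i).letter (Δ (n + 1)) ∧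
        ¬(Δ (n - 1) = i ∧ Δ n = i ∧ Δ (n + 1) = i ∧ w (n - 1) = rep [i] (n - 1))) ∨
      (∃ i j : Letter, i ≠ j ∧
        Θ (n - 1) = AM.E i ∧ Θ n = AM.E j ∧ Θ (n + 1) = AM.E i ∧
        (AM.E i).letter (Δ n) = (AM.E j).letter (Δ (n + 1)))) :
    ∃! v : Word, MissedBetween (w n) (w (n + 1)) v := by
  obtain ⟨m, rfl⟩ := Nat.exists_eq_add_of_le' hn
  simp only [show m + 2 - 1 = m + 1 from rfl] at hform
  have hp : (Θ (m + 1)).apply (w (m + 1)) = w (m + 1) := (hw.2 m).2.1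
  have hc := hw.2 (m + 1)
  have hpw : w (m + 1) <+: w (m + 2) := (List.prefix_append _ _).trans hc.1
  have hnorm' : ∀ v, v <+: w (m + 2) → IsPseudopal v →
      v.length ≤ (w (m + 1)).length ∨ v.length = (w (m + 2)).length := by
    intro v hv hpal
    obtain ⟨k, hk, rfl⟩ := hnorm v hv hpal
    rcases hk.eq_or_lt with rfl | hk
    · exact .inr rfl
    · exact .inl (hw.strictMono_length.monotone (Nat.le_of_lt_succ hk))
  have hfix : ∀ i a : Letter, (AM.E i).letter a = a → a = i := by decide
  rcases hform with ⟨i, hα, hβ, hγ, hb, hex⟩ | ⟨i, hα, hβ, hγ, hb, hex⟩ |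
    ⟨i, j, hij, hα, hβ, hγ, hb⟩
  · refine existsUnique_missed_of_period (α := .R) (β := .E i) (γ := .E i)
      (fun a => ?_) ?_ (hα ▸ hp) (hβ ▸ hc) (hγ ▸ hw.2 (m + 2)) hnorm' fun h hs => hex ?_
    · change _ = (AM.E i).letter ((AM.E i).letter ((AM.E i).letter a))
      rw [AM.letter_letter]
    · change _ = (AM.E i).letter (Δ (m + 2))
      rw [hb, AM.letter_letter]
    · obtain ⟨h1, h2⟩ := hw.eq_rep hnorm hpw ((AM.apply_eq_self_iff _ _).1 (hα ▸ hp)) hs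
      have h3 : Δ (m + 2) = i := hfix i _ h
      have h4 : (AM.E i).letter (Δ (m + 2)) = Δ (m + 2) := h
      exact ⟨h1, h3, by rw [← (AM.E i).letter_letter (Δ (m + 2 + 1)), ← hb, h4, h3], h2⟩
  · refine existsUnique_missed_of_period (α := .E i) (β := .R) (γ := .R)
      (fun a => ?_) ?_ (hα ▸ hp) (hβ ▸ hc) (hγ ▸ hw.2 (m + 2)) hnorm' fun h hs => hex ?_
    · change _ = (AM.E i).letter ((AM.E i).letter a)
      rw [AM.letter_letter]; rfl
    · change _ = (AM.E i).letter (Δ (m + 2))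
      rw [hb, AM.letter_letter]
    · obtain ⟨h1, h2⟩ := hw.eq_rep hnorm hpw
        (hs.congr (fun _ _ => rfl) fun a => (AM.E i).letter_letter a)
        ((AM.apply_eq_self_iff _ _).1 (hα ▸ hp))
      have h3 : Δ (m + 2) = i := hfix i _ h
      have h4 : (AM.E i).letter (Δ (m + 2)) = Δ (m + 2) := h
      exact ⟨h1, h3, by rw [← (AM.E i).letter_letter (Δ (m + 2 + 1)), ← hb, h4, h3], h2⟩
  · refine existsUnique_missed_of_period (α := .E i) (β := .E j) (γ := .E i)
      ?_ ?_ (hα ▸ hp) (hβ ▸ hc) (hγ ▸ hw.2 (m + 2)) hnorm' fun h => ?_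
    · have key : ∀ i j a : Letter, i ≠ j → (AM.E i).letter a = (AM.E j).letter
          ((AM.E i).letter ((AM.E j).letter ((AM.E i).letter ((AM.E j).letter a)))) := by decide
      exact fun a => key i j a hij
    · rw [← (AM.E j).letter_letter (Δ (m + 2 + 1)), ← hb]
    · have key : ∀ i j a : Letter, i ≠ j → (AM.E i).letter ((AM.E j).letter a) ≠ a := by decide
      exact absurd h (key i j _ hij)
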